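/- For binary D and Y, let the joint density of (X,D,Y) with respect to (Uniform[0,1]^K ⊗ counting ⊗ counting) induced by propensity m and outcome regression g be p_{m,g}(x,d,y) = m(x)^d (1−m(x))^{1−d} g(d,x)^y (1−g(d,x))^{1−y}. Suppose perturbed nuisances (m_λ, g_λ) satisfy, for all x: E_λ[m_λ(x)] = m̂(x), E_λ[m_λ(x) g_λ(1,x)] = m̂(x) ĝ(1,x), and g_λ(0,x) = ĝ(0,x) identically. Then the mixture density q(x,d,y) = E_λ[p_{m_λ, g_λ}(x,d,y)] equals p_{m̂,ĝ}(x,d,y) for all (x,d,y) ∈ [0,1]^K × {0,1} × {0,1}. -/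

import Mathlib

open MeasureTheory Set

/-- if the perturbed nuisances satisfy `E_λ[m_λ] = m̂`,
`E_λ[m_λ g_λ(1,·)] = m̂ ĝ(1,·)` and `g_λ(0,·) = ĝ(0,·)`, then the mixture of the
induced densities `p_{m_λ,g_λ}(x,d,y) = m_λ(x)^d (1−m_λ(x))^{1−d} g_λ(d,x)^y (1−g_λ(d,x))^{1−y}`
equals `p_{m̂,ĝ}` pointwise. -/
theorem stmt6 {K : ℕ} {ι : Type*} [Fintype ι]
    (π : ι → ℝ) (hπ0 : ∀ i, 0 ≤ π i) (hπ1 : ∑ i, π i = 1)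
    (mhat : (Fin K → ℝ) → ℝ) (ghat : Bool → (Fin K → ℝ) → ℝ)
    (m : ι → (Fin K → ℝ) → ℝ) (g : ι → Bool → (Fin K → ℝ) → ℝ)
    (hm01 : ∀ i x, m i x ∈ Set.Icc (0:ℝ) 1)
    (hg01 : ∀ i d x, g i d x ∈ Set.Icc (0:ℝ) 1)
    (hmhat01 : ∀ x, mhat x ∈ Set.Icc (0:ℝ) 1)
    (hghat01 : ∀ d x, ghat d x ∈ Set.Icc (0:ℝ) 1)
    (hmix_m : ∀ x, ∑ i, π i * m i x = mhat x)
    (hmix_mg : ∀ x, ∑ i, π i * (m i x * g i true x) = mhat x * ghat true x)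
    (hg0 : ∀ i x, g i false x = ghat false x) :
    ∀ x ∈ Set.Icc (0 : Fin K → ℝ) 1, ∀ d y : Bool,
      ∑ i, π i * ((if d then m i x else 1 - m i x) *
          (if y then g i d x else 1 - g i d x))
        = (if d then mhat x else 1 - mhat x) *
          (if y then ghat d x else 1 - ghat d x) := by
  intro x _ d y
  have one_sub_m : ∑ i, π i * (1 - m i x) = 1 - mhat x := by
    simp only [mul_sub, mul_one, Finset.sum_sub_distrib, hπ1, hmix_m]
  have treated : ∑ i, π i * (m i x * (1 - g i true x)) = mhat x * (1 - ghat true x) := by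
    simp only [mul_sub, mul_one, Finset.sum_sub_distrib, hmix_m, hmix_mg]
  cases d <;> cases y
  · simp only [Bool.false_eq_true, if_false, hg0, ← mul_assoc, ← Finset.sum_mul, one_sub_m]
  · simp only [Bool.false_eq_true, if_false, if_true, hg0, ← mul_assoc, ← Finset.sum_mul,
      one_sub_m]
  · simpa using treated
  · simpa using hmix_mg x
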